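/- Let q₁, q₂ ∈ L¹(0,π) be real-valued and let f₁, f₂ be rational Herglotz–Nevanlinna functions. For i = 1, 2 and λ ∈ ℝ not a pole of f_i, let φᵢ(·,λ) be the Carathéodory solution of −y″ + qᵢ·y = λ·y on [0,π] with φᵢ(0,λ) = 1 and φᵢ′(0,λ) = −f_i(λ). If φ₁′(π,λ)·φ₂(π,λ) = φ₂′(π,λ)·φ₁(π,λ) for every λ ∈ ℝ that is a pole of neither f₁ nor f₂ (i.e. the logarithmic derivatives φ₁′(π,·)/φ₁(π,·) and φ₂′(π,·)/φ₂(π,·) coincide), then q₁(x) = q₂(x) for almost every x ∈ (0,π) and f₁ = f₂. -/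

import Mathlib

open MeasureTheory Set

noncomputable section

/-- A rational Herglotz–Nevanlinna function, given by its canonical data:
`f(λ) = a·λ + c + Σ_j γ_j / (β_j − λ)` with `a ≥ 0`, `γ_j > 0` and `β_1 < … < β_n`. -/
structure RatHN where
  a : ℝ
  c : ℝ
  n : ℕ
  γ : Fin n → ℝ
  β : Fin n → ℝ
  ha : 0 ≤ a
  hγ : ∀ j, 0 < γ j
  hβ : StrictMono β

namespace RatHN

/-- The value `f(λ)` of a rational Herglotz–Nevanlinna function. -/
def eval (f : RatHN) (lam : ℝ) : ℝ :=
  f.a * lam + f.c + ∑ j : Fin f.n, f.γ j / (f.β j - lam)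

/-- `lam` is a pole of `f`. -/
def IsPole (f : RatHN) (lam : ℝ) : Prop := ∃ j, f.β j = lam

end RatHN

/-- A (Carathéodory) solution of `−y″ + Q·y = λ·y` on `[0, L]`:
a pair of continuous functions `y, y'` satisfying the two integral equations. -/
def IsCaraSol (Q : ℝ → ℝ) (L lam : ℝ) (y y' : ℝ → ℝ) : Prop :=
  ContinuousOn y (Icc 0 L) ∧ ContinuousOn y' (Icc 0 L) ∧
  (∀ x ∈ Icc (0:ℝ) L, y x = y 0 + ∫ t in (0:ℝ)..x, y' t) ∧
  (∀ x ∈ Icc (0:ℝ) L, y' x = y' 0 + ∫ t in (0:ℝ)..x, (Q t - lam) * y t)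

/-- `lam` is an eigenvalue of the problem `P(q, f, b)`, where `b : Option ℝ`
and `none` stands for the Dirichlet condition (`b = ∞`) at the right endpoint. -/
def IsEigen (q : ℝ → ℝ) (f : RatHN) (b : Option ℝ) (lam : ℝ) : Prop :=
  ∃ y y' : ℝ → ℝ, IsCaraSol q Real.pi lam y y' ∧
    (∃ x ∈ Icc (0:ℝ) Real.pi, y x ≠ 0) ∧
    (¬ f.IsPole lam → y' 0 = -f.eval lam * y 0) ∧
    (f.IsPole lam → y 0 = 0) ∧
    (∀ bb : ℝ, b = some bb → y' Real.pi = bb * y Real.pi) ∧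
    (b = none → y Real.pi = 0)

/-- The set of eigenvalues of the problem `P(q, f, b)`. -/
def eigenvalues (q : ℝ → ℝ) (f : RatHN) (b : Option ℝ) : Set ℝ :=
  {lam | IsEigen q f b lam}

/-- `Λ` is an enumeration of the set `S`: a strictly increasing sequence whose
range is exactly `S`. -/
def IsEnum (S : Set ℝ) (Λ : ℕ → ℝ) : Prop :=
  StrictMono Λ ∧ Set.range Λ = S

theorem absolutelyContinuousOnInterval_integral_complex {f : ℝ → ℂ} {a b : ℝ}
    (h : IntervalIntegrable f volume a b) :
    AbsolutelyContinuousOnInterval (fun x => ∫ v in a..x, f v) a b := by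
  have hr := h.norm.absolutelyContinuousOnInterval_intervalIntegral (c := a) left_mem_uIcc
  rw [absolutelyContinuousOnInterval_iff] at hr ⊢
  intro ε hε
  obtain ⟨δ, hδ, H⟩ := hr ε hε
  refine ⟨δ, hδ, fun E hE hlt => lt_of_le_of_lt (Finset.sum_le_sum fun i hi => ?_) (H E hE hlt)⟩
  obtain ⟨h1, h2⟩ := hE.1 i hi
  have i1 : IntervalIntegrable f volume a (E.2 i).1 :=
    h.mono_set (uIcc_subset_uIcc left_mem_uIcc h1)
  have i2 : IntervalIntegrable f volume a (E.2 i).2 :=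
    h.mono_set (uIcc_subset_uIcc left_mem_uIcc h2)
  rw [dist_eq_norm, dist_eq_norm, intervalIntegral.integral_interval_sub_left i1 i2,
    intervalIntegral.integral_interval_sub_left i1.norm i2.norm, Real.norm_eq_abs]
  exact intervalIntegral.norm_integral_le_abs_integral_norm

/-- `y` is, on `[0, L]`, the indefinite integral of the integrable function `a`. -/
def IsPrim (L : ℝ) (y a : ℝ → ℂ) : Prop :=
  IntervalIntegrable a volume 0 L ∧ ∀ x ∈ Icc (0:ℝ) L, y x = y 0 + ∫ t in (0:ℝ)..x, a t

namespace IsPrim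

variable {L : ℝ} {y z a b : ℝ → ℂ}

theorem intervalIntegrable (hy : IsPrim L y a) {x : ℝ} (hx : x ∈ Icc (0:ℝ) L) :
    IntervalIntegrable a volume 0 x :=
  hy.1.mono_set (by
    rw [uIcc_of_le hx.1, uIcc_of_le (hx.1.trans hx.2)]
    exact Icc_subset_Icc_right hx.2)

theorem continuousOn (hL : 0 ≤ L) (hy : IsPrim L y a) : ContinuousOn y (Icc 0 L) := by
  have h1 : ContinuousOn (fun x => y 0 + ∫ t in (0:ℝ)..x, a t) (Icc 0 L) := by
    have := intervalIntegral.continuousOn_primitive_interval' hy.1 (left_mem_uIcc)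
    rw [uIcc_of_le hL] at this
    exact continuousOn_const.add this
  exact h1.congr hy.2

theorem congr (hL : 0 ≤ L) (hy : IsPrim L y a) (hyz : EqOn y z (Icc 0 L))
    (hab : EqOn a b (Icc 0 L)) : IsPrim L z b := by
  refine ⟨?_, fun x hx => ?_⟩
  · refine hy.1.congr ?_
    rw [uIoc_of_le hL]
    exact hab.mono Ioc_subset_Icc_self
  · rw [← hyz hx, ← hyz (left_mem_Icc.2 hL), hy.2 x hx]
    congr 1
    refine intervalIntegral.integral_congr fun t ht => ?_
    rw [uIcc_of_le hx.1] at ht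
    exact hab ⟨ht.1, ht.2.trans hx.2⟩

theorem congr_right (hL : 0 ≤ L) (hy : IsPrim L y a) (hab : EqOn a b (Icc 0 L)) :
    IsPrim L y b := hy.congr hL (fun _ _ => rfl) hab

theorem add (hy : IsPrim L y a) (hz : IsPrim L z b) :
    IsPrim L (fun x => y x + z x) (fun x => a x + b x) := by
  refine ⟨hy.1.add hz.1, fun x hx => ?_⟩
  simp only
  rw [intervalIntegral.integral_add (hy.intervalIntegrable hx) (hz.intervalIntegrable hx),
    hy.2 x hx, hz.2 x hx]
  ring

theorem const_mul (c : ℂ) (hy : IsPrim L y a) :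
    IsPrim L (fun x => c * y x) (fun x => c * a x) := by
  refine ⟨hy.1.const_mul c, fun x hx => ?_⟩
  simp only
  rw [intervalIntegral.integral_const_mul, hy.2 x hx]
  ring

theorem sub (hy : IsPrim L y a) (hz : IsPrim L z b) :
    IsPrim L (fun x => y x - z x) (fun x => a x - b x) := by
  refine ⟨hy.1.sub hz.1, fun x hx => ?_⟩
  simp only
  rw [intervalIntegral.integral_sub (hy.intervalIntegrable hx) (hz.intervalIntegrable hx),
    hy.2 x hx, hz.2 x hx]
  ring

theorem of_hasDerivAt (h : ∀ x, HasDerivAt y (a x) x) (ha : Continuous a) : IsPrim L y a :=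
  ⟨ha.intervalIntegrable _ _, fun x _ => by
    rw [intervalIntegral.integral_eq_sub_of_hasDerivAt (fun t _ => h t)
      (ha.intervalIntegrable _ _)]
    ring⟩

theorem mul (hL : 0 ≤ L) (hy : IsPrim L y a) (hz : IsPrim L z b) :
    IsPrim L (fun x => y x * z x) (fun x => a x * z x + y x * b x) := by
  set Y : ℝ → ℂ := fun x => y 0 + ∫ t in (0:ℝ)..x, a t with hY
  set Z : ℝ → ℂ := fun x => z 0 + ∫ t in (0:ℝ)..x, b t with hZ
  have hyY : EqOn Y y (Icc 0 L) := fun x hx => (hy.2 x hx).symm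
  have hzZ : EqOn Z z (Icc 0 L) := fun x hx => (hz.2 x hx).symm
  have acc : ∀ c : ℂ, AbsolutelyContinuousOnInterval (fun _ : ℝ => c) 0 L := fun c =>
    (contDiffOn_const).absolutelyContinuousOnInterval
  have acY : AbsolutelyContinuousOnInterval Y 0 L :=
    (acc _).add (absolutelyContinuousOnInterval_integral_complex hy.1)
  have acZ : AbsolutelyContinuousOnInterval Z 0 L :=
    (acc _).add (absolutelyContinuousOnInterval_integral_complex hz.1)
  have int1 : IntervalIntegrable (fun x => a x * Z x + Y x * b x) volume 0 L :=
    (hy.1.mul_continuousOn acZ.continuousOn).add (hz.1.continuousOn_mul acY.continuousOn)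
  set P : ℝ → ℂ := fun x => Y x * Z x - ∫ t in (0:ℝ)..x, (a t * Z t + Y t * b t) with hP
  have acP : AbsolutelyContinuousOnInterval P 0 L :=
    (acY.smul acZ).sub (absolutelyContinuousOnInterval_integral_complex int1)
  have hder : ∀ᵐ x, x ∈ uIcc 0 L → HasDerivAt P 0 x := by
    filter_upwards [hy.1.ae_hasDerivAt_integral, hz.1.ae_hasDerivAt_integral,
      int1.ae_hasDerivAt_integral] with x h1 h2 h3 hx
    have e1 : HasDerivAt Y (a x) x := (h1 hx 0 left_mem_uIcc).const_add _
    have e2 : HasDerivAt Z (b x) x := (h2 hx 0 left_mem_uIcc).const_add _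
    have := (e1.mul e2).sub (h3 hx 0 left_mem_uIcc)
    rw [sub_self] at this
    exact this
  obtain ⟨C, hC⟩ := acP.const_of_ae_hasDerivAt_zero hder
  rw [uIcc_of_le hL] at hC
  have key : IsPrim L (fun x => Y x * Z x) (fun x => a x * Z x + Y x * b x) := by
    refine ⟨int1, fun x hx => ?_⟩
    have h1 := hC x hx
    have h0 := hC 0 (left_mem_Icc.2 hL)
    simp only [hP, intervalIntegral.integral_same, sub_zero] at h1 h0
    change Y x * Z x = Y 0 * Z 0 + ∫ t in (0:ℝ)..x, (a t * Z t + Y t * b t)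
    rw [h0, ← h1]
    ring
  refine key.congr hL (fun x hx => ?_) (fun x hx => ?_)
  · simp only [hyY hx, hzZ hx]
  · simp only [hyY hx, hzZ hx]

theorem reflect (hL : 0 ≤ L) (hy : IsPrim L y a) :
    IsPrim L (fun s => y (L - s)) (fun s => -a (L - s)) := by
  have hint : IntervalIntegrable (fun s => a (L - s)) volume 0 L := by
    have := hy.1.comp_sub_left L
    simpa using this.symm
  refine ⟨hint.neg, fun x hx => ?_⟩
  have hx' : L - x ∈ Icc (0:ℝ) L := ⟨by linarith [hx.2], by linarith [hx.1]⟩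
  simp only [intervalIntegral.integral_neg, intervalIntegral.integral_comp_sub_left, sub_zero]
  rw [hy.2 _ hx', hy.2 L (right_mem_Icc.2 hL),
    ← intervalIntegral.integral_add_adjacent_intervals (b := L - x) (hy.intervalIntegrable hx')
      ((hy.intervalIntegrable hx').symm.trans hy.1)]
  ring

theorem eq_of_zero (hy : IsPrim L y (fun _ => 0)) {x : ℝ} (hx : x ∈ Icc (0:ℝ) L) :
    y x = y 0 := by
  simpa using hy.2 x hx

end IsPrim

/-- Complex Carathéodory solutions `(y, z = y')` of `-y″ + Q y = lam y` on `[0, L]`. -/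
def IsSol (Q : ℝ → ℂ) (L : ℝ) (lam : ℂ) (y z : ℝ → ℂ) : Prop :=
  IsPrim L y z ∧ IsPrim L z (fun t => (Q t - lam) * y t)

namespace IsSol

variable {Q : ℝ → ℂ} {L : ℝ} {lam : ℂ} {y z u u' v v' : ℝ → ℂ}

theorem reflect (hL : 0 ≤ L) (h : IsSol Q L lam y z) :
    IsSol (fun s => Q (L - s)) L lam (fun s => y (L - s)) (fun s => -z (L - s)) := by
  refine ⟨h.1.reflect hL, ?_⟩
  have := (h.2.reflect hL).const_mul (-1)
  refine this.congr hL (fun x _ => ?_) (fun x _ => ?_)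
  · simp
  · simp

theorem wronskian (hL : 0 ≤ L) (h : IsSol Q L lam u u') (k : IsSol Q L lam v v') {x : ℝ}
    (hx : x ∈ Icc (0:ℝ) L) : u x * v' x - u' x * v x = u 0 * v' 0 - u' 0 * v 0 := by
  have := ((h.1.mul hL k.2).sub (h.2.mul hL k.1)).congr_right (b := fun _ => 0) hL
    (fun t _ => by ring)
  exact this.eq_of_zero hx

theorem eq_comb (hL : 0 ≤ L) (hu : IsSol Q L lam u u') (hv : IsSol Q L lam v v')
    (hy : IsSol Q L lam y z) (hu0 : u 0 = 1) (hu0' : u' 0 = 0) (hv0 : v 0 = 0)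
    (hv0' : v' 0 = 1) {x : ℝ} (hx : x ∈ Icc (0:ℝ) L) : y x = y 0 * u x + z 0 * v x := by
  have h1 := hu.wronskian hL hv hx
  have h2 := hy.wronskian hL hv hx
  have h3 := hu.wronskian hL hy hx
  rw [hu0, hu0', hv0, hv0'] at *
  linear_combination -y x * h1 + u x * h2 + v x * h3

/-- A family of exponentially weighted combinations of a solution is an indefinite integral. -/
theorem isPrim_exp (hL : 0 ≤ L) {κ : ℂ} (h : IsSol Q L (-κ ^ 2) y z) :
    IsPrim L (fun x => Complex.exp (-κ * x) * (z x + κ * y x))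
      (fun x => Complex.exp (-κ * x) * (Q x * y x)) := by
  have he : IsPrim L (fun x => Complex.exp (-κ * x)) (fun x => -κ * Complex.exp (-κ * x)) := by
    refine IsPrim.of_hasDerivAt (fun x => ?_) (by fun_prop)
    have h1 : HasDerivAt (fun x : ℝ => -κ * (x : ℂ)) (-κ) x := by
      simpa using (Complex.ofRealCLM.hasDerivAt (x := x)).const_mul (-κ)
    simpa [mul_comm] using h1.cexp
  refine (he.mul hL (h.2.add (h.1.const_mul κ))).congr_right hL (fun x _ => ?_)
  ring

theorem continuousOn (hL : 0 ≤ L) (h : IsSol Q L lam y z) : ContinuousOn y (Icc 0 L) :=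
  h.1.continuousOn hL

theorem norm_integral_exp_le (hL : 0 ≤ L) {κ : ℂ} (hQ : IntervalIntegrable Q volume 0 L) {σ S : ℝ}
    (hS : ∀ t ∈ Icc (0:ℝ) L, ‖y t‖ ≤ S * Real.exp (σ * t)) {x : ℝ} (hx : x ∈ Icc (0:ℝ) L)
    {M : ℝ} (hM : ∀ t ∈ Icc (0:ℝ) x, Real.exp (-κ.re * t) * Real.exp (σ * t) ≤ M) :
    ‖∫ t in (0:ℝ)..x, Complex.exp (-κ * t) * (Q t * y t)‖ ≤
      (∫ t in (0:ℝ)..L, ‖Q t‖) * (S * M) := by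
  have hS0 : 0 ≤ S := by
    have := (norm_nonneg _).trans (hS 0 ⟨le_rfl, hL⟩)
    simpa using this
  have hQx : IntervalIntegrable Q volume 0 x := hQ.mono_set (by
    rw [uIcc_of_le hx.1, uIcc_of_le hL]; exact Icc_subset_Icc_right hx.2)
  have hM0 : 0 ≤ M := (by positivity : (0:ℝ) ≤ _).trans (hM 0 ⟨le_rfl, hx.1⟩)
  calc ‖∫ t in (0:ℝ)..x, Complex.exp (-κ * t) * (Q t * y t)‖
      ≤ ∫ t in (0:ℝ)..x, ‖Q t‖ * (S * M) := by
        refine intervalIntegral.norm_integral_le_of_norm_le hx.1 ?_ (hQx.norm.mul_const _)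
        refine Filter.Eventually.of_forall fun t ht => ?_
        have ht1 : t ∈ Icc (0:ℝ) x := ⟨ht.1.le, ht.2⟩
        have ht2 : t ∈ Icc (0:ℝ) L := ⟨ht.1.le, ht.2.trans hx.2⟩
        rw [norm_mul, norm_mul, Complex.norm_exp]
        have e1 : (-κ * (t:ℂ)).re = -κ.re * t := by simp
        rw [e1]
        calc Real.exp (-κ.re * t) * (‖Q t‖ * ‖y t‖)
            ≤ Real.exp (-κ.re * t) * (‖Q t‖ * (S * Real.exp (σ * t))) := by
              gcongr; exact hS t ht2
          _ = ‖Q t‖ * (S * (Real.exp (-κ.re * t) * Real.exp (σ * t))) := by ring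
          _ ≤ ‖Q t‖ * (S * M) := by gcongr; exact hM t ht1
    _ = (∫ t in (0:ℝ)..x, ‖Q t‖) * (S * M) := intervalIntegral.integral_mul_const _ _
    _ ≤ (∫ t in (0:ℝ)..L, ‖Q t‖) * (S * M) := by
        gcongr
        exact intervalIntegral.integral_mono_interval le_rfl hx.1 hx.2
          (Filter.Eventually.of_forall fun t => norm_nonneg _) hQ.norm

/-- The growing component of a solution. -/
theorem growing_component (hL : 0 ≤ L) {κ : ℂ} (hQ : IntervalIntegrable Q volume 0 L)
    (h : IsSol Q L (-κ ^ 2) y z) {S : ℝ}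
    (hS : ∀ t ∈ Icc (0:ℝ) L, ‖y t‖ ≤ S * Real.exp (κ.re * t)) {x : ℝ} (hx : x ∈ Icc (0:ℝ) L) :
    ‖Complex.exp (-κ * x) * (z x + κ * y x) - (z 0 + κ * y 0)‖ ≤
      (∫ t in (0:ℝ)..L, ‖Q t‖) * S := by
  have h1 := (h.isPrim_exp hL).2 x hx
  simp only [Complex.ofReal_zero, mul_zero, Complex.exp_zero, one_mul] at h1
  rw [h1, add_sub_cancel_left]
  have := norm_integral_exp_le hL (κ := κ) hQ hS hx (M := 1) (fun t _ => by
    rw [← Real.exp_add]; simp)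
  simpa using this

/-- The decaying component of a solution. -/
theorem decaying_component (hL : 0 ≤ L) {κ : ℂ} (hκ : 0 ≤ κ.re)
    (hQ : IntervalIntegrable Q volume 0 L)
    (h : IsSol Q L (-κ ^ 2) y z) {S : ℝ}
    (hS : ∀ t ∈ Icc (0:ℝ) L, ‖y t‖ ≤ S * Real.exp (κ.re * t)) {x : ℝ} (hx : x ∈ Icc (0:ℝ) L) :
    ‖Complex.exp (-κ * x) * (z x - κ * y x)‖ ≤
      Real.exp (-2 * κ.re * x) * ‖z 0 - κ * y 0‖ + (∫ t in (0:ℝ)..L, ‖Q t‖) * S := by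
  have h' : IsSol Q L (-(-κ) ^ 2) y z := by simpa using h
  have h1 := (h'.isPrim_exp hL).2 x hx
  simp only [Complex.ofReal_zero, mul_zero, Complex.exp_zero, one_mul, neg_neg] at h1
  have h2 := norm_integral_exp_le hL (κ := -κ) hQ hS hx (M := Real.exp (2 * κ.re * x))
    (fun t ht => by
      rw [← Real.exp_add, Real.exp_le_exp]
      simp only [Complex.neg_re, neg_neg]
      nlinarith [ht.2])
  have h3 : Complex.exp (-κ * x) * (z x - κ * y x) =
      Complex.exp (-2 * κ * x) * (Complex.exp (κ * x) * (z x + -κ * y x)) := by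
    rw [← mul_assoc, ← Complex.exp_add]
    ring_nf
  have h4 : (-2 * κ * (x:ℂ)).re = -2 * κ.re * x := by simp
  rw [h3, h1, norm_mul, Complex.norm_exp, h4]
  simp only [neg_neg] at h2
  have h5 : Real.exp (-2 * κ.re * x) * Real.exp (2 * κ.re * x) = 1 := by
    rw [← Real.exp_add]; simp
  calc Real.exp (-2 * κ.re * x) * ‖z 0 + -κ * y 0 +
          ∫ t in (0:ℝ)..x, Complex.exp (κ * t) * (Q t * y t)‖
      ≤ Real.exp (-2 * κ.re * x) * (‖z 0 + -κ * y 0‖ +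
          (∫ t in (0:ℝ)..L, ‖Q t‖) * (S * Real.exp (2 * κ.re * x))) := by
        gcongr
        exact (norm_add_le _ _).trans (by gcongr)
    _ = Real.exp (-2 * κ.re * x) * ‖z 0 - κ * y 0‖ + (∫ t in (0:ℝ)..L, ‖Q t‖) * S *
          (Real.exp (-2 * κ.re * x) * Real.exp (2 * κ.re * x)) := by
        rw [neg_mul κ, ← sub_eq_add_neg]; ring
    _ = _ := by rw [h5, mul_one]

theorem upper_bound (hL : 0 ≤ L) {κ : ℂ} (hκ : 0 ≤ κ.re) (hκ0 : κ ≠ 0)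
    (hQ : IntervalIntegrable Q volume 0 L) (hκQ : 2 * (∫ t in (0:ℝ)..L, ‖Q t‖) ≤ ‖κ‖)
    (h : IsSol Q L (-κ ^ 2) y z) {x : ℝ} (hx : x ∈ Icc (0:ℝ) L) :
    ‖y x‖ ≤ (‖z 0 + κ * y 0‖ + ‖z 0 - κ * y 0‖) / ‖κ‖ * Real.exp (κ.re * x) := by
  have hκp : 0 < ‖κ‖ := norm_pos_iff.2 hκ0
  obtain ⟨x₀, hx₀, hmax⟩ := isCompact_Icc.exists_isMaxOn (nonempty_Icc.2 hL)
    (f := fun t => ‖y t‖ * Real.exp (-κ.re * t))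
    ((h.continuousOn hL).norm.mul (by fun_prop))
  set S := ‖y x₀‖ * Real.exp (-κ.re * x₀) with hSdef
  have hS : ∀ t ∈ Icc (0:ℝ) L, ‖y t‖ ≤ S * Real.exp (κ.re * t) := by
    intro t ht
    have h1 : ‖y t‖ * Real.exp (-κ.re * t) ≤ S := hmax ht
    calc ‖y t‖ = ‖y t‖ * Real.exp (-κ.re * t) * Real.exp (κ.re * t) := by
          rw [mul_assoc, ← Real.exp_add]; simp
      _ ≤ _ := by gcongr
  have hg := h.growing_component hL hQ hS hx₀
  have hd := h.decaying_component hL hκ hQ hS hx₀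
  have hN : 0 ≤ ∫ t in (0:ℝ)..L, ‖Q t‖ :=
    intervalIntegral.integral_nonneg hL fun _ _ => norm_nonneg _
  have hS0 : 0 ≤ S := by positivity
  have key : 2 * ‖κ‖ * S ≤ ‖z 0 + κ * y 0‖ + ‖z 0 - κ * y 0‖ +
      2 * ((∫ t in (0:ℝ)..L, ‖Q t‖) * S) := by
    have e1 : 2 * ‖κ‖ * S = ‖Complex.exp (-κ * x₀) * (z x₀ + κ * y x₀) -
        Complex.exp (-κ * x₀) * (z x₀ - κ * y x₀)‖ := by
      rw [← mul_sub, show z x₀ + κ * y x₀ - (z x₀ - κ * y x₀) = 2 * κ * y x₀ by ring,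
        norm_mul, norm_mul, norm_mul, Complex.norm_exp, hSdef]
      simp; ring
    rw [e1]
    have e2 : Real.exp (-2 * κ.re * x₀) ≤ 1 := by
      rw [Real.exp_le_one_iff]; nlinarith [hx₀.1, mul_nonneg hκ hx₀.1]
    have e3 := norm_sub_le (Complex.exp (-κ * x₀) * (z x₀ + κ * y x₀))
      (Complex.exp (-κ * x₀) * (z x₀ - κ * y x₀))
    have e4 := norm_sub_norm_le (Complex.exp (-κ * x₀) * (z x₀ + κ * y x₀)) (z 0 + κ * y 0)
    have e5 := mul_le_of_le_one_left (norm_nonneg (z 0 - κ * y 0)) e2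
    linarith
  have hSle : S ≤ (‖z 0 + κ * y 0‖ + ‖z 0 - κ * y 0‖) / ‖κ‖ := by
    rw [le_div_iff₀ hκp]
    nlinarith
  exact (hS x hx).trans (by gcongr)

/-- For a solution with `y 0 = 1` whose initial slope is bounded below by `-k / 2`, the quotient
`y x / y L` decays like `exp (-k (L - x))`. -/
theorem ratio_bound (hL : 0 ≤ L) {k b : ℝ} (hk : 0 < k) (hkL : 2 ≤ k * L)
    (hQ : IntervalIntegrable Q volume 0 L) (hkQ : 32 * (∫ t in (0:ℝ)..L, ‖Q t‖) ≤ k)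
    (hb : -k / 2 ≤ b) (h : IsSol Q L (-(k:ℂ) ^ 2) y z) (hy0 : y 0 = 1) (hz0 : z 0 = b) :
    y L ≠ 0 ∧ ∀ x ∈ Icc (0:ℝ) L, ‖y x‖ ≤ 16 * Real.exp (-k * (L - x)) * ‖y L‖ := by
  have hN : 0 ≤ ∫ t in (0:ℝ)..L, ‖Q t‖ :=
    intervalIntegral.integral_nonneg hL fun _ _ => norm_nonneg _
  set N := ∫ t in (0:ℝ)..L, ‖Q t‖ with hNdef
  have hψ : ‖z 0 + k * y 0‖ = b + k := by
    rw [hy0, hz0, mul_one, ← Complex.ofReal_add, Complex.norm_real, Real.norm_of_nonneg]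
    linarith
  have hχ : ‖z 0 - k * y 0‖ ≤ 3 * (b + k) := by
    rw [hy0, hz0, mul_one, ← Complex.ofReal_sub, Complex.norm_real, Real.norm_eq_abs, abs_le]
    constructor <;> linarith
  have hknorm : ‖(k:ℂ)‖ = k := by simp [abs_of_pos hk]
  have hψpos : 0 < b + k := by linarith
  have hS : ∀ t ∈ Icc (0:ℝ) L, ‖y t‖ ≤ 4 * (b + k) / k * Real.exp ((k:ℂ).re * t) := by
    intro t ht
    refine (h.upper_bound hL (by simpa using hk.le) (by exact_mod_cast hk.ne') hQ
      (by rw [hknorm]; linarith) ht).trans ?_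
    rw [hknorm, hψ]
    gcongr
    linarith
  have hR : L ∈ Icc (0:ℝ) L := right_mem_Icc.2 hL
  have hg := h.growing_component hL hQ hS hR
  have hd := h.decaying_component hL (by simpa using hk.le) hQ hS hR
  rw [← hNdef] at hg hd
  simp only [Complex.ofReal_re] at hd hS
  have hNS : N * (4 * (b + k) / k) ≤ (b + k) / 8 := by
    rw [mul_div_assoc', div_le_iff₀ hk]
    nlinarith
  have hexp : Real.exp (-2 * k * L) ≤ 1 / 12 := by
    have h1 : Real.exp (-2 * k * L) ≤ Real.exp (-(4:ℝ)) := by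
      rw [Real.exp_le_exp]; linarith
    have h2 : (12:ℝ) ≤ Real.exp 4 := by
      have : (2:ℝ) ≤ Real.exp 1 := by linarith [Real.add_one_le_exp (1:ℝ)]
      calc (12:ℝ) ≤ 2 ^ 4 := by norm_num
        _ ≤ Real.exp 1 ^ 4 := by gcongr
        _ = Real.exp 4 := by rw [← Real.exp_nat_mul]; norm_num
    rw [Real.exp_neg] at h1
    refine h1.trans ?_
    rw [one_div]
    gcongr
  have hlow : (b + k) / 2 ≤ 2 * k * (Real.exp (-k * L) * ‖y L‖) := by
    have e1 : 2 * k * (Real.exp (-k * L) * ‖y L‖) =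
        ‖Complex.exp (-(k:ℂ) * L) * (z L + k * y L) -
        Complex.exp (-(k:ℂ) * L) * (z L - k * y L)‖ := by
      rw [← mul_sub, show z L + k * y L - (z L - k * y L) = 2 * k * y L by ring,
        norm_mul, norm_mul, norm_mul, Complex.norm_exp, hknorm]
      simp; ring
    rw [e1]
    have e3 := norm_sub_norm_le (Complex.exp (-(k:ℂ) * L) * (z L + k * y L))
      (Complex.exp (-(k:ℂ) * L) * (z L - k * y L))
    have e4 := norm_sub_norm_le (z 0 + k * y 0) (Complex.exp (-(k:ℂ) * L) * (z L + k * y L))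
    rw [norm_sub_rev, hψ] at e4
    have e5 : Real.exp (-2 * k * L) * ‖z 0 - k * y 0‖ ≤ 1 / 12 * (3 * (b + k)) := by
      gcongr
    linarith
  have hyL : 0 < ‖y L‖ := by
    by_contra hcon
    have : ‖y L‖ = 0 := le_antisymm (not_lt.1 hcon) (norm_nonneg _)
    rw [this] at hlow
    simp at hlow
    linarith
  refine ⟨norm_pos_iff.1 hyL, fun x hx => (hS x hx).trans ?_⟩
  have hlow2 : (b + k) / k ≤ 4 * (Real.exp (-k * L) * ‖y L‖) := by
    rw [div_le_iff₀ hk]; linarith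
  calc 4 * (b + k) / k * Real.exp (k * x) = 4 * ((b + k) / k) * Real.exp (k * x) := by ring
    _ ≤ 4 * (4 * (Real.exp (-k * L) * ‖y L‖)) * Real.exp (k * x) := by gcongr
    _ = 16 * (Real.exp (-k * L) * Real.exp (k * x)) * ‖y L‖ := by ring
    _ = 16 * Real.exp (-k * (L - x)) * ‖y L‖ := by
      rw [← Real.exp_add]; ring_nf

end IsSol

theorem integral_mul_pow_div_factorial {h : ℝ → ℝ} {L : ℝ} (hL : 0 ≤ L)
    (hh : IntervalIntegrable h volume 0 L) (n : ℕ) {x : ℝ} (hx : x ∈ Icc (0:ℝ) L) :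
    ∫ t in (0:ℝ)..x, h t * ((∫ s in (0:ℝ)..t, h s) ^ n / n.factorial) =
      (∫ s in (0:ℝ)..x, h s) ^ (n + 1) / (n + 1).factorial := by
  set H : ℝ → ℂ := fun x => ((∫ s in (0:ℝ)..x, h s : ℝ) : ℂ) with hH
  have p1 : IsPrim L H (fun t => (h t : ℂ)) := by
    refine ⟨⟨hh.1.ofReal, hh.2.ofReal⟩, fun x _ => ?_⟩
    simp [hH, intervalIntegral.integral_ofReal]
  have key : ∀ n : ℕ, IsPrim L (fun x => H x ^ (n + 1))
      (fun t => (n + 1) * ((h t : ℂ) * H t ^ n)) := by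
    intro n
    induction n with
    | zero => simpa using p1
    | succ n ih =>
      refine (ih.mul hL p1).congr hL (fun t _ => by ring) (fun t _ => ?_)
      push_cast
      ring
  have h1 := (key n).2 x hx
  have h0 : H 0 = 0 := by simp [hH]
  simp only at h1
  rw [h0, zero_pow (Nat.succ_ne_zero n), zero_add, intervalIntegral.integral_const_mul] at h1
  have h2 : ((∫ t in (0:ℝ)..x, h t * ((∫ s in (0:ℝ)..t, h s) ^ n) : ℝ) : ℂ) =
      ∫ t in (0:ℝ)..x, (h t : ℂ) * H t ^ n := by
    rw [← intervalIntegral.integral_ofReal]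
    simp [hH]
  rw [← h2] at h1
  have h3 : (∫ s in (0:ℝ)..x, h s) ^ (n + 1) =
      (n + 1) * ∫ t in (0:ℝ)..x, h t * ((∫ s in (0:ℝ)..t, h s) ^ n) := by
    apply Complex.ofReal_injective
    push_cast [hH] at h1 ⊢
    exact h1
  simp_rw [mul_div_assoc']
  rw [intervalIntegral.integral_div, h3, Nat.factorial_succ]
  push_cast
  have : (n.factorial : ℝ) ≠ 0 := by positivity
  field_simp

/-- The Volterra operator `f ↦ ∫₀ˣ k f` on `C([0, L])`. -/
noncomputable def volterra {L : ℝ} (hL : 0 ≤ L) (k : ℝ → ℂ)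
    (hk : IntervalIntegrable k volume 0 L) : C(Icc (0:ℝ) L, ℂ) →L[ℂ] C(Icc (0:ℝ) L, ℂ) :=
  have hint : ∀ f : C(Icc (0:ℝ) L, ℂ),
      IntervalIntegrable (fun t => k t * f (projIcc 0 L hL t)) volume 0 L := fun f =>
    hk.mul_continuousOn (f.continuous.comp continuous_projIcc).continuousOn
  have hint' : ∀ (f : C(Icc (0:ℝ) L, ℂ)) (x : Icc (0:ℝ) L),
      IntervalIntegrable (fun t => k t * f (projIcc 0 L hL t)) volume 0 x := fun f x =>
    (hint f).mono_set (by
      rw [uIcc_of_le x.2.1, uIcc_of_le hL]; exact Icc_subset_Icc_right x.2.2)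
  LinearMap.mkContinuous
    { toFun := fun f =>
        ⟨fun x => ∫ t in (0:ℝ)..x, k t * f (projIcc 0 L hL t), by
          have := intervalIntegral.continuousOn_primitive_interval' (hint f) left_mem_uIcc
          rw [uIcc_of_le hL] at this
          exact this.domRestrict⟩
      map_add' := fun f g => by
        ext x
        simp only [ContinuousMap.coe_add, Pi.add_apply, ContinuousMap.coe_mk, mul_add]
        exact intervalIntegral.integral_add (hint' f x) (hint' g x)
      map_smul' := fun c f => by
        ext x
        simp only [ContinuousMap.coe_smul, Pi.smul_apply, ContinuousMap.coe_mk, smul_eq_mul,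
          RingHom.id_apply, mul_left_comm _ c]
        exact intervalIntegral.integral_const_mul _ _ }
    (∫ t in (0:ℝ)..L, ‖k t‖)
    (fun f => by
      refine (ContinuousMap.norm_le _ (mul_nonneg
        (intervalIntegral.integral_nonneg hL fun _ _ => norm_nonneg _) (norm_nonneg _))).2
        fun x => ?_
      have hkx : IntervalIntegrable k volume 0 x := hk.mono_set (by
        rw [uIcc_of_le x.2.1, uIcc_of_le hL]; exact Icc_subset_Icc_right x.2.2)
      calc ‖∫ t in (0:ℝ)..x, k t * f (projIcc 0 L hL t)‖
          ≤ ∫ t in (0:ℝ)..x, ‖k t‖ * ‖f‖ := by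
            refine intervalIntegral.norm_integral_le_of_norm_le x.2.1
              (Filter.Eventually.of_forall fun t _ => ?_) (hkx.norm.mul_const _)
            rw [norm_mul]
            gcongr
            exact f.norm_coe_le_norm _
        _ = (∫ t in (0:ℝ)..x, ‖k t‖) * ‖f‖ := intervalIntegral.integral_mul_const _ _
        _ ≤ (∫ t in (0:ℝ)..L, ‖k t‖) * ‖f‖ := by
            gcongr
            exact intervalIntegral.integral_mono_interval le_rfl x.2.1 x.2.2
              (Filter.Eventually.of_forall fun t => norm_nonneg _) hk.norm)

theorem isUnit_one_sub_of_norm_pow_lt_one {R : Type*} [NormedRing R] [CompleteSpace R] {x : R}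
    {n : ℕ} (h : ‖x ^ n‖ < 1) : IsUnit (1 - x) := by
  have hu : IsUnit (1 - x ^ n) := isUnit_one_sub_of_norm_lt_one h
  have hcomm : Commute (1 - x) (∑ i ∈ Finset.range n, x ^ i) := by
    refine Commute.sum_right _ _ _ fun i _ => ?_
    exact (Commute.one_left _).sub_left ((Commute.refl x).pow_right i)
  rw [← mul_neg_geom_sum] at hu
  exact (hcomm.isUnit_mul_iff.1 hu).1

theorem differentiable_inverse_one_sub_mul {R : Type*} [NormedRing R] [NormedAlgebra ℂ R]
    [CompleteSpace R] (J K : R) (h : ∀ lam : ℂ, IsUnit (1 - J * (K - lam • J))) :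
    Differentiable ℂ fun lam : ℂ => Ring.inverse (1 - J * (K - lam • J)) := by
  intro lam
  have e1 : DifferentiableAt ℂ (fun lam : ℂ => 1 - J * (K - lam • J)) lam := by fun_prop
  exact DifferentiableAt.comp lam (differentiableAt_inverse (h lam)) e1

section Volterra

variable {L : ℝ} (hL : 0 ≤ L)

theorem volterra_apply {k : ℝ → ℂ} (hk : IntervalIntegrable k volume 0 L)
    (f : C(Icc (0:ℝ) L, ℂ)) (x : Icc (0:ℝ) L) :
    volterra hL k hk f x = ∫ t in (0:ℝ)..x, k t * f (projIcc 0 L hL t) := rfl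

theorem intervalIntegrable_mul_proj {k : ℝ → ℂ} (hk : IntervalIntegrable k volume 0 L)
    (f : C(Icc (0:ℝ) L, ℂ)) :
    IntervalIntegrable (fun t => k t * f (projIcc 0 L hL t)) volume 0 L :=
  hk.mul_continuousOn (f.continuous.comp continuous_projIcc).continuousOn

theorem volterra_bound {k : ℝ → ℂ} (hk : IntervalIntegrable k volume 0 L) {h : ℝ → ℝ}
    (hh : IntervalIntegrable h volume 0 L) (hkh : ∀ t, ‖k t‖ ≤ h t) {f : C(Icc (0:ℝ) L, ℂ)}
    {C : ℝ} {n : ℕ}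
    (hf : ∀ x : Icc (0:ℝ) L, ‖f x‖ ≤ C * ((∫ s in (0:ℝ)..x, h s) ^ n / n.factorial))
    (x : Icc (0:ℝ) L) :
    ‖volterra hL k hk f x‖ ≤ C * ((∫ s in (0:ℝ)..x, h s) ^ (n + 1) / (n + 1).factorial) := by
  rw [volterra_apply, ← integral_mul_pow_div_factorial hL hh n x.2,
    ← intervalIntegral.integral_const_mul]
  have hsub : uIcc (0:ℝ) x ⊆ uIcc 0 L := by
    rw [uIcc_of_le x.2.1, uIcc_of_le hL]; exact Icc_subset_Icc_right x.2.2
  refine intervalIntegral.norm_integral_le_of_norm_le x.2.1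
    (Filter.Eventually.of_forall fun t ht => ?_) ?_
  · have htI : t ∈ Icc (0:ℝ) L := ⟨ht.1.le, ht.2.trans x.2.2⟩
    rw [norm_mul, projIcc_of_mem hL htI]
    have h1 := hf ⟨t, htI⟩
    calc ‖k t‖ * ‖f ⟨t, htI⟩‖ ≤ h t * (C * ((∫ s in (0:ℝ)..t, h s) ^ n / n.factorial)) := by
          have := hkh t
          have := (norm_nonneg _).trans this
          gcongr
      _ = _ := by ring
  · refine IntervalIntegrable.const_mul ?_ _
    have hc : ContinuousOn (fun t => (∫ s in (0:ℝ)..t, h s) ^ n / (n.factorial : ℝ)) (uIcc 0 L) :=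
      ((intervalIntegral.continuousOn_primitive_interval' hh left_mem_uIcc).pow n).div_const _
    exact (hh.mul_continuousOn hc).mono_set hsub

theorem isUnit_one_sub_volterra_mul {k₁ k₂ : ℝ → ℂ} (hk₁ : IntervalIntegrable k₁ volume 0 L)
    (hk₂ : IntervalIntegrable k₂ volume 0 L) :
    IsUnit (1 - volterra hL k₁ hk₁ * volterra hL k₂ hk₂) := by
  set T := volterra hL k₁ hk₁ * volterra hL k₂ hk₂ with hT
  set h : ℝ → ℝ := fun t => ‖k₁ t‖ + ‖k₂ t‖ with hh_def
  have hh : IntervalIntegrable h volume 0 L := hk₁.norm.add hk₂.norm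
  have hpow : ∀ (n : ℕ) (f : C(Icc (0:ℝ) L, ℂ)) (x : Icc (0:ℝ) L), ‖(T ^ n) f x‖ ≤
      ‖f‖ * ((∫ s in (0:ℝ)..x, h s) ^ (2 * n) / (2 * n).factorial) := by
    intro n f
    induction n with
    | zero => intro x; simpa using f.norm_coe_le_norm x
    | succ n ih =>
      intro x
      rw [pow_succ']
      exact volterra_bound hL hk₁ hh (fun t => by simp [hh_def])
        (fun x => volterra_bound hL hk₂ hh (fun t => by simp [hh_def]) ih x) x
  have hH : ∀ x : Icc (0:ℝ) L, 0 ≤ ∫ s in (0:ℝ)..x, h s := fun x =>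
    intervalIntegral.integral_nonneg x.2.1 fun _ _ => by positivity
  have hHL : ∀ x : Icc (0:ℝ) L, ∫ s in (0:ℝ)..x, h s ≤ ∫ s in (0:ℝ)..L, h s := fun x =>
    intervalIntegral.integral_mono_interval le_rfl x.2.1 x.2.2
      (Filter.Eventually.of_forall fun t => by positivity) hh
  have hL0 : 0 ≤ ∫ s in (0:ℝ)..L, h s :=
    intervalIntegral.integral_nonneg hL fun _ _ => by positivity
  have hnorm : ∀ n : ℕ, ‖T ^ n‖ ≤ (∫ s in (0:ℝ)..L, h s) ^ (2 * n) / (2 * n).factorial := by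
    intro n
    refine ContinuousLinearMap.opNorm_le_bound _ (by positivity) fun f => ?_
    refine (ContinuousMap.norm_le _ (by positivity)).2 fun x => (hpow n f x).trans ?_
    rw [mul_comm]
    have := hH x
    have := hHL x
    gcongr
  obtain ⟨n, hn⟩ : ∃ n : ℕ,
      (∫ s in (0:ℝ)..L, h s) ^ (2 * n) / ((2 * n).factorial : ℝ) < 1 := by
    have h1 := (FloorSemiring.tendsto_pow_div_factorial_atTop (∫ s in (0:ℝ)..L, h s))
    have h2 : Filter.Tendsto (fun n : ℕ => 2 * n) Filter.atTop Filter.atTop :=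
      Filter.tendsto_id.const_mul_atTop' (by norm_num)
    exact ((h1.comp h2).eventually_lt_const zero_lt_one).exists
  exact isUnit_one_sub_of_norm_pow_lt_one (R := C(Icc (0:ℝ) L, ℂ) →L[ℂ] C(Icc (0:ℝ) L, ℂ))
    (x := T) (n := n) ((hnorm n).trans_lt hn)

end Volterra

/-- Solutions of the initial value problem exist for every complex `lam` and are entire in it. -/
theorem exists_entire_solution {Q : ℝ → ℂ} {L : ℝ} (hL : 0 ≤ L)
    (hQ : IntervalIntegrable Q volume 0 L) (α β : ℂ) :
    ∃ y z : ℂ → ℝ → ℂ, (∀ lam, IsSol Q L lam (y lam) (z lam)) ∧ (∀ lam, y lam 0 = α) ∧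
      (∀ lam, z lam 0 = β) ∧ ∀ x, Differentiable ℂ fun lam => y lam x := by
  have h1 : IntervalIntegrable (fun _ : ℝ => (1:ℂ)) volume 0 L := intervalIntegrable_const
  have hQl : ∀ lam : ℂ, IntervalIntegrable (fun t => Q t - lam) volume 0 L := fun lam =>
    hQ.sub intervalIntegrable_const
  set J := volterra hL _ h1
  set K := volterra hL Q hQ
  have hK : ∀ lam, volterra hL _ (hQl lam) = K - lam • J := by
    intro lam
    ext f x
    have hsub : uIcc (0:ℝ) x ⊆ uIcc 0 L := by
      rw [uIcc_of_le x.2.1, uIcc_of_le hL]; exact Icc_subset_Icc_right x.2.2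
    simp only [J, K, sub_apply, smul_apply,
      ContinuousMap.sub_apply, ContinuousMap.smul_apply, volterra_apply, smul_eq_mul]
    rw [← intervalIntegral.integral_const_mul, ← intervalIntegral.integral_sub
      ((intervalIntegrable_mul_proj hL hQ f).mono_set hsub)
      (((intervalIntegrable_mul_proj hL h1 f).mono_set hsub).const_mul lam)]
    congr 1
    ext t
    ring
  have hunit : ∀ lam : ℂ, IsUnit (1 - J * (K - lam • J)) := fun lam => by
    rw [← hK]
    exact isUnit_one_sub_volterra_mul hL h1 (hQl lam)
  set η : C(Icc (0:ℝ) L, ℂ) := ⟨fun x => α + β * (x : ℝ), by fun_prop⟩ with hη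
  set Y : ℂ → C(Icc (0:ℝ) L, ℂ) := fun lam => Ring.inverse (1 - J * (K - lam • J)) η with hY
  have hfix : ∀ lam, Y lam = η + J ((K - lam • J) (Y lam)) := by
    intro lam
    have h2 : ((1 - J * (K - lam • J)) * Ring.inverse (1 - J * (K - lam • J))) η = η := by
      rw [Ring.mul_inverse_cancel _ (hunit lam)]
      rfl
    have h3 : Y lam - J ((K - lam • J) (Y lam)) = η := h2
    rw [← h3]
    abel
  have hdiff : Differentiable ℂ Y := by
    intro lam
    have e3 := differentiable_inverse_one_sub_mul J K hunit lam
    exact e3.clm_apply (differentiableAt_const η)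
  refine ⟨fun lam x => Y lam (projIcc 0 L hL x),
    fun lam x => β + ((K - lam • J) (Y lam)) (projIcc 0 L hL x), fun lam => ⟨?_, ?_⟩, ?_, ?_, ?_⟩
  · refine ⟨Continuous.intervalIntegrable (continuous_const.add
      ((ContinuousMap.continuous _).comp continuous_projIcc)) _ _, fun x hx => ?_⟩
    have e0 : (Y lam) (projIcc 0 L hL 0) = α := by
      rw [hfix]
      simp [J, volterra_apply, hη]
    simp only [e0]
    rw [hfix lam, ContinuousMap.add_apply, ← hfix lam]
    have hc : Continuous fun t => ((K - lam • J) (Y lam)) (projIcc 0 L hL t) :=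
      (ContinuousMap.continuous _).comp continuous_projIcc
    rw [intervalIntegral.integral_add intervalIntegrable_const (hc.intervalIntegrable _ _)]
    simp only [J, volterra_apply, hη, ContinuousMap.coe_mk, projIcc_of_mem hL hx, one_mul,
      intervalIntegral.integral_const, sub_zero, Complex.real_smul]
    ring
  · refine ⟨intervalIntegrable_mul_proj hL (hQl lam) (Y lam), fun x hx => ?_⟩
    simp only [← hK, volterra_apply, projIcc_left, intervalIntegral.integral_same, add_zero]
    rw [projIcc_of_mem hL hx]
  · intro lam
    simp only
    rw [hfix]
    simp [J, volterra_apply, hη]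
  · intro lam
    simp [← hK, volterra_apply]
  · intro x lam
    exact ((ContinuousMap.evalCLM ℂ (projIcc 0 L hL x)).differentiable.differentiableAt).comp lam
      (hdiff lam)

/-- A Phragmén–Lindelöf type uniqueness theorem for entire functions of exponential type. -/
theorem eq_zero_of_bounds_on_axes {G : ℂ → ℂ} (hG : Differentiable ℂ G) {C R B : ℝ}
    (hexp : ∀ w : ℂ, R ≤ ‖w‖ → ‖G w‖ ≤ C * Real.exp (B * ‖w‖))
    (hre : ∀ x : ℝ, R ≤ |x| → ‖G x‖ ≤ C / |x|)
    (him : ∀ t : ℝ, R ≤ |t| → ‖G (t * Complex.I)‖ ≤ C) (w : ℂ) : G w = 0 := by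
  set R₁ := max R 1 with hR₁
  have hC : 0 ≤ C := (norm_nonneg _).trans (him R₁ ((le_max_left _ _).trans (le_abs_self _)))
  obtain ⟨M, hM⟩ := (isCompact_closedBall (0:ℂ) R₁).exists_bound_of_continuousOn
    hG.continuous.continuousOn
  set D := max C M
  have hre' : ∀ x : ℝ, ‖G x‖ ≤ D := by
    intro x
    rcases le_total |x| R₁ with h | h
    · exact (hM x (by simpa using h)).trans (le_max_right _ _)
    · refine (hre x ((le_max_left _ _).trans h)).trans ((div_le_self hC ?_).trans (le_max_left _ _))
      exact (le_max_right _ _).trans h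
  have him' : ∀ t : ℝ, ‖G (t * Complex.I)‖ ≤ D := by
    intro t
    rcases le_total |t| R₁ with h | h
    · exact (hM _ (by simpa using h)).trans (le_max_right _ _)
    · exact (him t ((le_max_left _ _).trans h)).trans (le_max_left _ _)
  have hO : ∀ s : Set ℂ, ∃ c < (2:ℝ), ∃ B,
      G =O[Bornology.cobounded ℂ ⊓ Filter.principal s] fun z => Real.exp (B * ‖z‖ ^ c) := by
    intro s
    refine ⟨1, one_lt_two, B, Asymptotics.IsBigO.of_bound C ?_⟩
    refine Filter.Eventually.filter_mono inf_le_left ?_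
    filter_upwards [(tendsto_norm_cobounded_atTop (E := ℂ)).eventually_ge_atTop R] with z hz
    simpa using hexp z hz
  have hD : ∀ z, ‖G z‖ ≤ D := by
    intro z
    rcases le_total 0 z.re with h1 | h1 <;> rcases le_total 0 z.im with h2 | h2
    · exact PhragmenLindelof.quadrant_I hG.diffContOnCl (hO _) (fun x _ => hre' x)
        (fun x _ => him' x) h1 h2
    · exact PhragmenLindelof.quadrant_IV hG.diffContOnCl (hO _) (fun x _ => hre' x)
        (fun x _ => him' x) h1 h2
    · exact PhragmenLindelof.quadrant_II hG.diffContOnCl (hO _) (fun x _ => hre' x)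
        (fun x _ => him' x) h1 h2
    · exact PhragmenLindelof.quadrant_III hG.diffContOnCl (hO _) (fun x _ => hre' x)
        (fun x _ => him' x) h1 h2
  have hconst := hG.apply_eq_apply_of_bounded 
    (isBounded_iff_forall_norm_le.2 ⟨D, Set.forall_mem_range.2 hD⟩)
  have hle : ∀ x : ℝ, R₁ ≤ x → ‖G w‖ ≤ C / x := by
    intro x hx
    have hx0 : 0 ≤ x := zero_le_one.trans ((le_max_right _ _).trans hx)
    have := hre x (by rw [abs_of_nonneg hx0]; exact (le_max_left _ _).trans hx)
    rwa [abs_of_nonneg hx0, ← hconst w] at this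
  have hlim : Filter.Tendsto (fun x : ℝ => C / x) Filter.atTop (nhds 0) :=
    Filter.tendsto_id.const_div_atTop C
  have := ge_of_tendsto hlim ((Filter.eventually_ge_atTop R₁).mono hle)
  exact norm_le_zero_iff.1 this

/-- `u` and `v` are the solutions with initial values `(1, 0)` and `(0, 1)`, and are entire in
the spectral parameter. -/
structure IsFund (Q : ℝ → ℂ) (L : ℝ) (u u' v v' : ℂ → ℝ → ℂ) : Prop where
  solU : ∀ lam, IsSol Q L lam (u lam) (u' lam)
  solV : ∀ lam, IsSol Q L lam (v lam) (v' lam)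
  u_zero : ∀ lam, u lam 0 = 1
  u'_zero : ∀ lam, u' lam 0 = 0
  v_zero : ∀ lam, v lam 0 = 0
  v'_zero : ∀ lam, v' lam 0 = 1
  diffU : ∀ x, Differentiable ℂ fun lam => u lam x
  diffV : ∀ x, Differentiable ℂ fun lam => v lam x

theorem exists_isFund {Q : ℝ → ℂ} {L : ℝ} (hL : 0 ≤ L) (hQ : IntervalIntegrable Q volume 0 L) :
    ∃ u u' v v' : ℂ → ℝ → ℂ, IsFund Q L u u' v v' := by
  obtain ⟨u, u', h1, h2, h3, h4⟩ := exists_entire_solution hL hQ 1 0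
  obtain ⟨v, v', k1, k2, k3, k4⟩ := exists_entire_solution hL hQ 0 1
  exact ⟨u, u', v, v', h1, k1, h2, h3, k2, k3, h4, k4⟩

namespace IsFund

variable {Q : ℝ → ℂ} {L : ℝ} {u u' v v' : ℂ → ℝ → ℂ}

theorem norm_le (F : IsFund Q L u u' v v') (hL : 0 ≤ L) (hQ : IntervalIntegrable Q volume 0 L)
    {w : ℂ} (hw : w ≠ 0) (hwQ : 2 * (∫ t in (0:ℝ)..L, ‖Q t‖) ≤ ‖w‖) {x : ℝ}
    (hx : x ∈ Icc (0:ℝ) L) :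
    ‖u (w ^ 2) x‖ ≤ 2 * Real.exp (|w.im| * x) ∧
      ‖v (w ^ 2) x‖ ≤ 2 / ‖w‖ * Real.exp (|w.im| * x) := by
  obtain ⟨κ, hre, hsq, hnorm⟩ : ∃ κ : ℂ, κ.re = |w.im| ∧ w ^ 2 = -κ ^ 2 ∧ ‖κ‖ = ‖w‖ := by
    rcases le_total 0 w.im with h | h
    · exact ⟨-(Complex.I * w), by simp [abs_of_nonneg h], by
        rw [neg_sq, mul_pow, Complex.I_sq]; ring, by simp⟩
    · exact ⟨Complex.I * w, by simp [abs_of_nonpos h], by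
        rw [mul_pow, Complex.I_sq]; ring, by simp⟩
  have hκp : 0 < ‖κ‖ := by rw [hnorm]; exact norm_pos_iff.2 hw
  have hκ0 : κ ≠ 0 := norm_pos_iff.1 hκp
  have hre0 : 0 ≤ κ.re := hre ▸ abs_nonneg _
  rw [hsq, ← hre, ← hnorm]
  rw [← hnorm] at hwQ
  have h1 := (F.solU (-κ ^ 2)).upper_bound hL hre0 hκ0 hQ hwQ hx
  have h2 := (F.solV (-κ ^ 2)).upper_bound hL hre0 hκ0 hQ hwQ hx
  rw [F.u_zero, F.u'_zero] at h1
  rw [F.v_zero, F.v'_zero] at h2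
  constructor
  · convert h1 using 2
    simp
    field_simp
    norm_num
  · convert h2 using 3
    simp
    norm_num

end IsFund

theorem integral_norm_nonneg {Q : ℝ → ℂ} {L : ℝ} (hL : 0 ≤ L) :
    0 ≤ ∫ t in (0:ℝ)..L, ‖Q t‖ :=
  intervalIntegral.integral_nonneg hL fun _ _ => norm_nonneg _

/-- If the logarithmic derivatives at `L` of suitable solutions agree along a ray, then the
fundamental solutions normalized at `L` satisfy `u₁ v₂ = u₂ v₁`. -/
theorem fund_cross_eq {Q₁ Q₂ : ℝ → ℂ} {L : ℝ} (hL : 0 < L)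
    (hQ₁ : IntervalIntegrable Q₁ volume 0 L) (hQ₂ : IntervalIntegrable Q₂ volume 0 L)
    {u₁ u₁' v₁ v₁' u₂ u₂' v₂ v₂' : ℂ → ℝ → ℂ}
    (F₁ : IsFund (fun s => Q₁ (L - s)) L u₁ u₁' v₁ v₁')
    (F₂ : IsFund (fun s => Q₂ (L - s)) L u₂ u₂' v₂ v₂')
    {k₀ : ℝ} (H : ∀ k : ℝ, k₀ ≤ k → ∃ (b₁ b₂ : ℝ) (y₁ z₁ y₂ z₂ : ℝ → ℂ),
      -k / 2 ≤ b₁ ∧ -k / 2 ≤ b₂ ∧ IsSol Q₁ L (-(k:ℂ) ^ 2) y₁ z₁ ∧ IsSol Q₂ L (-(k:ℂ) ^ 2) y₂ z₂ ∧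
      y₁ 0 = 1 ∧ z₁ 0 = b₁ ∧ y₂ 0 = 1 ∧ z₂ 0 = b₂ ∧ z₁ L * y₂ L = z₂ L * y₁ L)
    (lam : ℂ) {s : ℝ} (hs : s ∈ Icc (0:ℝ) L) : u₁ lam s * v₂ lam s = u₂ lam s * v₁ lam s := by
  have hQ₁r : IntervalIntegrable (fun s => Q₁ (L - s)) volume 0 L := by
    simpa using (hQ₁.comp_sub_left L).symm
  have hQ₂r : IntervalIntegrable (fun s => Q₂ (L - s)) volume 0 L := by
    simpa using (hQ₂.comp_sub_left L).symm
  have n1 := integral_norm_nonneg (Q := Q₁) hL.le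
  have n2 := integral_norm_nonneg (Q := Q₂) hL.le
  have n3 := integral_norm_nonneg (Q := fun s => Q₁ (L - s)) hL.le
  have n4 := integral_norm_nonneg (Q := fun s => Q₂ (L - s)) hL.le
  have hL2 : 0 < 2 / L := by positivity
  set R : ℝ := |k₀| + 2 / L + 32 * (∫ t in (0:ℝ)..L, ‖Q₁ t‖) + 32 * (∫ t in (0:ℝ)..L, ‖Q₂ t‖) +
    2 * (∫ t in (0:ℝ)..L, ‖Q₁ (L - t)‖) + 2 * (∫ t in (0:ℝ)..L, ‖Q₂ (L - t)‖) + 1 with hR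
  have ha := abs_nonneg k₀
  have ha' := le_abs_self k₀
  have hne : ∀ w : ℂ, R ≤ ‖w‖ → w ≠ 0 := fun w hw => norm_pos_iff.1 (by linarith)
  have b1 : ∀ w : ℂ, R ≤ ‖w‖ → _ := fun w hw =>
    F₁.norm_le hL.le hQ₁r (hne w hw) (by linarith) hs
  have b2 : ∀ w : ℂ, R ≤ ‖w‖ → _ := fun w hw =>
    F₂.norm_le hL.le hQ₂r (hne w hw) (by linarith) hs
  set G : ℂ → ℂ := fun w => u₁ (w ^ 2) s * v₂ (w ^ 2) s - u₂ (w ^ 2) s * v₁ (w ^ 2) s with hG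
  have hGd : Differentiable ℂ G := by
    have hp : Differentiable ℂ fun w : ℂ => w ^ 2 := by fun_prop
    exact (((F₁.diffU s).comp hp).mul ((F₂.diffV s).comp hp)).sub
      (((F₂.diffU s).comp hp).mul ((F₁.diffV s).comp hp))
  have hGb : ∀ w : ℂ, R ≤ ‖w‖ → ‖G w‖ ≤ 8 / ‖w‖ * Real.exp (2 * (|w.im| * s)) := by
    intro w hw
    obtain ⟨p1, p2⟩ := b1 w hw
    obtain ⟨p3, p4⟩ := b2 w hw
    calc ‖G w‖ ≤ ‖u₁ (w ^ 2) s‖ * ‖v₂ (w ^ 2) s‖ + ‖u₂ (w ^ 2) s‖ * ‖v₁ (w ^ 2) s‖ := by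
          rw [← norm_mul, ← norm_mul]; exact norm_sub_le _ _
      _ ≤ (2 * Real.exp (|w.im| * s)) * (2 / ‖w‖ * Real.exp (|w.im| * s)) +
          (2 * Real.exp (|w.im| * s)) * (2 / ‖w‖ * Real.exp (|w.im| * s)) := by gcongr
      _ = _ := by rw [two_mul (|w.im| * s), Real.exp_add]; ring
  have hzero : ∀ w, G w = 0 := by
    refine eq_zero_of_bounds_on_axes (C := 64) (R := R) (B := 2 * L) hGd ?_ ?_ ?_
    · intro w hw
      have hw1 : 1 ≤ ‖w‖ := by linarith
      refine (hGb w hw).trans ?_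
      have h1 : 8 / ‖w‖ ≤ 64 := (div_le_self (by norm_num) hw1).trans (by norm_num)
      have h2 : |w.im| * s ≤ ‖w‖ * L :=
        mul_le_mul (Complex.abs_im_le_norm w) hs.2 hs.1 (norm_nonneg _)
      have h3 : 2 * (|w.im| * s) ≤ 2 * L * ‖w‖ := by linarith
      exact mul_le_mul h1 (Real.exp_le_exp.2 h3) (Real.exp_pos _).le (by norm_num)
    · intro x hx
      have h1 := hGb x (by simpa using hx)
      simp only [Complex.ofReal_im, abs_zero, zero_mul, mul_zero, Real.exp_zero, mul_one,
        Complex.norm_real, Real.norm_eq_abs] at h1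
      refine h1.trans ?_
      gcongr
      norm_num
    · intro t ht
      set k := |t| with hk
      have hk1 : 1 ≤ k := by linarith
      have hkp : 0 < k := by linarith
      have hnorm : ‖(t * Complex.I : ℂ)‖ = k := by simp [hk]
      have him : |((t:ℂ) * Complex.I).im| = k := by simp [hk]
      have hsq : ((t:ℂ) * Complex.I) ^ 2 = -(k:ℂ) ^ 2 := by
        rw [mul_pow, Complex.I_sq, hk, ← Complex.ofReal_pow |t|, sq_abs]
        push_cast
        ring
      obtain ⟨c1, c2, y₁, z₁, y₂, z₂, hb1, hb2, s1, s2, i1, i2, i3, i4, hcross⟩ :=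
        H k (by linarith)
      have hkL : 2 ≤ k * L := by
        have : 2 / L ≤ k := by linarith
        rwa [div_le_iff₀ hL] at this
      obtain ⟨A1, R1⟩ := s1.ratio_bound hL.le hkp hkL hQ₁ (by linarith) hb1 i1 i2
      obtain ⟨A2, R2⟩ := s2.ratio_bound hL.le hkp hkL hQ₂ (by linarith) hb2 i3 i4
      have hs' : L - s ∈ Icc (0:ℝ) L := ⟨by linarith [hs.2], by linarith [hs.1]⟩
      have r1 := R1 _ hs'
      have r2 := R2 _ hs'
      rw [sub_sub_cancel] at r1 r2
      have e1 := (F₁.solU _).eq_comb hL.le (F₁.solV _) (s1.reflect hL.le) (F₁.u_zero _)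
        (F₁.u'_zero _) (F₁.v_zero _) (F₁.v'_zero _) hs
      have e2 := (F₂.solU _).eq_comb hL.le (F₂.solV _) (s2.reflect hL.le) (F₂.u_zero _)
        (F₂.u'_zero _) (F₂.v_zero _) (F₂.v'_zero _) hs
      simp only [sub_zero] at e1 e2
      have p1 := (b1 (t * Complex.I) (by rw [hnorm]; exact ht)).2
      have p2 := (b2 (t * Complex.I) (by rw [hnorm]; exact ht)).2
      rw [hnorm, him, hsq] at p1 p2
      have key : y₁ L * y₂ L * G (t * Complex.I) =
          y₂ L * y₁ (L - s) * v₂ (-(k:ℂ) ^ 2) s - y₁ L * y₂ (L - s) * v₁ (-(k:ℂ) ^ 2) s := by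
        simp only [hG, hsq, e1, e2]
        linear_combination v₁ (-(k:ℂ) ^ 2) s * v₂ (-(k:ℂ) ^ 2) s * hcross
      have hpos : 0 < ‖y₁ L‖ * ‖y₂ L‖ := by positivity
      have hexp : Real.exp (-k * s) * Real.exp (k * s) = 1 := by
        rw [← Real.exp_add]; simp
      have hle : ‖y₁ L‖ * ‖y₂ L‖ * ‖G (t * Complex.I)‖ ≤ ‖y₁ L‖ * ‖y₂ L‖ * (64 / k) := by
        rw [← norm_mul, ← norm_mul, key]
        calc _ ≤ ‖y₂ L‖ * ‖y₁ (L - s)‖ * ‖v₂ (-(k:ℂ) ^ 2) s‖ +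
              ‖y₁ L‖ * ‖y₂ (L - s)‖ * ‖v₁ (-(k:ℂ) ^ 2) s‖ := by
              simp only [← norm_mul]; exact norm_sub_le _ _
          _ ≤ ‖y₂ L‖ * (16 * Real.exp (-k * s) * ‖y₁ L‖) * (2 / k * Real.exp (k * s)) +
              ‖y₁ L‖ * (16 * Real.exp (-k * s) * ‖y₂ L‖) * (2 / k * Real.exp (k * s)) := by
              gcongr
          _ = ‖y₁ L‖ * ‖y₂ L‖ * (64 / k) * (Real.exp (-k * s) * Real.exp (k * s)) := by ring
          _ = ‖y₁ L * y₂ L‖ * (64 / k) := by rw [hexp, mul_one, norm_mul]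
      have := le_of_mul_le_mul_left hle hpos
      exact this.trans (div_le_self (by norm_num) hk1)
  obtain ⟨w, rfl⟩ := IsAlgClosed.exists_pow_nat_eq lam zero_lt_two
  exact sub_eq_zero.1 (hzero w)

namespace IsPrim

variable {L : ℝ} {y z a b : ℝ → ℂ}

theorem ae_eq_zero (hy : IsPrim L y a) (h0 : ∀ x ∈ Icc (0:ℝ) L, y x = 0) :
    ∀ᵐ x, x ∈ Ioo (0:ℝ) L → a x = 0 := by
  filter_upwards [hy.1.ae_hasDerivAt_integral] with x h hx
  have hL : 0 ≤ L := (hx.1.trans hx.2).le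
  have h1 := h (by rw [uIcc_of_le hL]; exact Ioo_subset_Icc_self hx) 0 left_mem_uIcc
  refine h1.unique ((hasDerivAt_const x (0:ℂ)).congr_of_eventuallyEq ?_)
  filter_upwards [Icc_mem_nhds hx.1 hx.2] with t ht
  have := hy.2 t ht
  rw [h0 t ht, h0 0 ⟨le_rfl, hL⟩, zero_add] at this
  exact this.symm

theorem eq_zero_of_continuousOn (hL : 0 < L) (hy : IsPrim L y a)
    (h0 : ∀ x ∈ Icc (0:ℝ) L, y x = 0) (ha : ContinuousOn a (Icc 0 L)) {x : ℝ}
    (hx : x ∈ Icc (0:ℝ) L) : a x = 0 := by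
  refine Measure.eqOn_Icc_of_ae_eq volume hL.ne (g := fun _ => 0) ?_ ha continuousOn_const hx
  rw [← restrict_Ioo_eq_restrict_Icc]
  exact (ae_restrict_iff' measurableSet_Ioo).2 (hy.ae_eq_zero h0)

end IsPrim

/-- Two potentials whose fundamental solutions satisfy `u₁ v₂ = u₂ v₁` coincide. -/
theorem ae_eq_of_cross_eq {Q₁ Q₂ : ℝ → ℂ} {L : ℝ} (hL : 0 < L) {lam : ℂ}
    {u₁ u₁' v₁ v₁' u₂ u₂' v₂ v₂' : ℝ → ℂ}
    (hu₁ : IsSol Q₁ L lam u₁ u₁') (hv₁ : IsSol Q₁ L lam v₁ v₁')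
    (hu₂ : IsSol Q₂ L lam u₂ u₂') (hv₂ : IsSol Q₂ L lam v₂ v₂')
    (iu₁ : u₁ 0 = 1) (iu₁' : u₁' 0 = 0) (iv₁ : v₁ 0 = 0) (iv₁' : v₁' 0 = 1)
    (iu₂ : u₂ 0 = 1) (iu₂' : u₂' 0 = 0) (iv₂ : v₂ 0 = 0) (iv₂' : v₂' 0 = 1)
    (hc : ∀ s ∈ Icc (0:ℝ) L, u₁ s * v₂ s = u₂ s * v₁ s) :
    ∀ᵐ x, x ∈ Ioo (0:ℝ) L → Q₁ x = Q₂ x := by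
  have w1 : ∀ s ∈ Icc (0:ℝ) L, u₁ s * v₁' s - u₁' s * v₁ s = 1 := fun s hs => by
    rw [hu₁.wronskian hL.le hv₁ hs, iu₁, iu₁', iv₁, iv₁']; ring
  have w2 : ∀ s ∈ Icc (0:ℝ) L, u₂ s * v₂' s - u₂' s * v₂ s = 1 := fun s hs => by
    rw [hu₂.wronskian hL.le hv₂ hs, iu₂, iu₂', iv₂, iv₂']; ring
  have cu₁ := hu₁.1.continuousOn hL.le
  have cu₁' := hu₁.2.continuousOn hL.le
  have cv₁ := hv₁.1.continuousOn hL.le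
  have cv₁' := hv₁.2.continuousOn hL.le
  have cu₂ := hu₂.1.continuousOn hL.le
  have cu₂' := hu₂.2.continuousOn hL.le
  have cv₂ := hv₂.1.continuousOn hL.le
  have cv₂' := hv₂.2.continuousOn hL.le
  have hd : ∀ s ∈ Icc (0:ℝ) L,
      (u₁' s * v₂ s + u₁ s * v₂' s) - (u₂' s * v₁ s + u₂ s * v₁' s) = 0 := fun s hs =>
    ((hu₁.1.mul hL.le hv₂.1).sub (hu₂.1.mul hL.le hv₁.1)).eq_zero_of_continuousOn hL
      (fun x hx => sub_eq_zero.2 (hc x hx))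
      (((cu₁'.mul cv₂).add (cu₁.mul cv₂')).sub ((cu₂'.mul cv₁).add (cu₂.mul cv₁'))) hs
  set ρ : ℝ → ℂ := fun s => u₂ s * v₁' s - v₂ s * u₁' s with hρ
  have cρ : ContinuousOn ρ (Icc 0 L) := (cu₂.mul cv₁').sub (cv₂.mul cu₁')
  have eu : ∀ s ∈ Icc (0:ℝ) L, u₂ s = ρ s * u₁ s := fun s hs => by
    simp only [hρ]
    linear_combination -u₂ s * w1 s hs + u₁' s * hc s hs
  have ev : ∀ s ∈ Icc (0:ℝ) L, v₂ s = ρ s * v₁ s := fun s hs => by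
    simp only [hρ]
    linear_combination -v₂ s * w1 s hs + v₁' s * hc s hs
  have eu' : ∀ s ∈ Icc (0:ℝ) L, u₁ s = ρ s * u₂ s := fun s hs => by
    simp only [hρ]
    linear_combination -u₁ s * w2 s hs - u₂' s * hc s hs + u₂ s * hd s hs
  have ev' : ∀ s ∈ Icc (0:ℝ) L, v₁ s = ρ s * v₂ s := fun s hs => by
    simp only [hρ]
    linear_combination -v₁ s * w2 s hs - v₂' s * hc s hs + v₂ s * hd s hs
  have hsq : EqOn (ρ ^ 2) ((fun _ => 1) ^ 2) (Icc 0 L) := fun s hs => by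
    simp only [Pi.pow_apply, one_pow]
    have p1 : (ρ s ^ 2 - 1) * u₁ s = 0 := by
      linear_combination -ρ s * eu s hs - eu' s hs
    have p2 : (ρ s ^ 2 - 1) * v₁ s = 0 := by
      linear_combination -ρ s * ev s hs - ev' s hs
    linear_combination v₁' s * p1 - u₁' s * p2 - (ρ s ^ 2 - 1) * w1 s hs
  have h0 : (0:ℝ) ∈ Icc (0:ℝ) L := ⟨le_rfl, hL.le⟩
  have hρ1 : ∀ s ∈ Icc (0:ℝ) L, ρ s = 1 := by
    rcases isPreconnected_Icc.eq_or_eq_neg_of_sq_eq cρ continuousOn_const hsq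
      (fun _ => one_ne_zero) with h | h
    · exact h
    · have h1 := h h0
      simp only [hρ, iu₂, iv₁', iv₂, Pi.neg_apply] at h1
      norm_num at h1
  have du : ∀ s ∈ Icc (0:ℝ) L, u₁ s - u₂ s = 0 := fun s hs => by
    rw [eu s hs, hρ1 s hs]; ring
  have dv : ∀ s ∈ Icc (0:ℝ) L, v₁ s - v₂ s = 0 := fun s hs => by
    rw [ev s hs, hρ1 s hs]; ring
  have du' : ∀ s ∈ Icc (0:ℝ) L, u₁' s - u₂' s = 0 := fun s hs =>
    (hu₁.1.sub hu₂.1).eq_zero_of_continuousOn hL du (cu₁'.sub cu₂') hs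
  have dv' : ∀ s ∈ Icc (0:ℝ) L, v₁' s - v₂' s = 0 := fun s hs =>
    (hv₁.1.sub hv₂.1).eq_zero_of_continuousOn hL dv (cv₁'.sub cv₂') hs
  filter_upwards [(hu₁.2.sub hu₂.2).ae_eq_zero du', (hv₁.2.sub hv₂.2).ae_eq_zero dv'] with
    x h1 h2 hx
  have hxI := Ioo_subset_Icc_self hx
  have p1 := h1 hx
  have p2 := h2 hx
  rw [← sub_eq_zero.1 (du x hxI)] at p1
  rw [← sub_eq_zero.1 (dv x hxI)] at p2
  linear_combination v₁' x * p1 - u₁' x * p2 - (Q₁ x - Q₂ x) * w1 x hxI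

namespace RatHN

theorem exists_eval_neg_sq_le (f : RatHN) :
    ∃ k₀ : ℝ, 1 ≤ k₀ ∧ ∀ k : ℝ, k₀ ≤ k → ¬ f.IsPole (-k ^ 2) ∧ f.eval (-k ^ 2) ≤ k / 2 := by
  have hB : 0 ≤ ∑ j, |f.β j| := Finset.sum_nonneg fun j _ => abs_nonneg _
  have hc : 0 ≤ |f.c + ∑ j, f.γ j| := abs_nonneg _
  refine ⟨1 + 2 * |f.c + ∑ j, f.γ j| + ∑ j, |f.β j|, by linarith, fun k hk => ?_⟩
  have hpos : ∀ j, 1 ≤ f.β j + k ^ 2 := by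
    intro j
    have h1 : |f.β j| ≤ ∑ j, |f.β j| :=
      Finset.single_le_sum (f := fun j => |f.β j|) (fun j _ => abs_nonneg _) (Finset.mem_univ j)
    have h2 := neg_abs_le (f.β j)
    nlinarith
  constructor
  · rintro ⟨j, hj⟩
    have := hpos j
    rw [hj] at this
    linarith
  · have h1 : ∑ j, f.γ j / (f.β j - -k ^ 2) ≤ ∑ j, f.γ j := by
      refine Finset.sum_le_sum fun j _ => div_le_self (f.hγ j).le ?_
      linarith [hpos j]
    have h2 : 0 ≤ f.a * k ^ 2 := mul_nonneg f.ha (sq_nonneg k)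
    have h3 := le_abs_self (f.c + ∑ j, f.γ j)
    unfold eval
    linarith

/-- Minus the residue of `f` at `p`. -/
def weight (f : RatHN) (p : ℝ) : ℝ := ∑ j, if f.β j = p then f.γ j else 0

theorem weight_β (f : RatHN) (i : Fin f.n) : f.weight (f.β i) = f.γ i := by
  simp [weight, f.hβ.injective.eq_iff]

theorem weight_ne_zero_iff (f : RatHN) (p : ℝ) : f.weight p ≠ 0 ↔ p ∈ range f.β := by
  constructor
  · intro h
    by_contra hp
    refine h (Finset.sum_eq_zero fun j _ => if_neg fun hj => hp ⟨j, hj⟩)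
  · rintro ⟨i, rfl⟩
    rw [weight_β]
    exact (f.hγ i).ne'

theorem tendsto_mul_eval (f : RatHN) (p : ℝ) :
    Filter.Tendsto (fun x => (p - x) * f.eval x) (nhdsWithin p {p}ᶜ) (nhds (f.weight p)) := by
  have h1 : Filter.Tendsto (fun x => (p - x) * (f.a * x + f.c)) (nhdsWithin p {p}ᶜ) (nhds 0) := by
    have : Filter.Tendsto (fun x => (p - x) * (f.a * x + f.c)) (nhds p)
        (nhds ((p - p) * (f.a * p + f.c))) := Continuous.tendsto (by fun_prop) p
    rw [sub_self, zero_mul] at this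
    exact this.mono_left nhdsWithin_le_nhds
  have h2 : ∀ j, Filter.Tendsto (fun x => (p - x) * (f.γ j / (f.β j - x))) (nhdsWithin p {p}ᶜ)
      (nhds (if f.β j = p then f.γ j else 0)) := by
    intro j
    split_ifs with h
    · refine tendsto_const_nhds.congr' ?_
      filter_upwards [self_mem_nhdsWithin] with x hx
      have : p - x ≠ 0 := sub_ne_zero.2 (Ne.symm hx)
      rw [h]
      field_simp
    · have : ContinuousAt (fun x => (p - x) * (f.γ j / (f.β j - x))) p :=
        (continuousAt_const.sub continuousAt_id).mul
          (continuousAt_const.div (continuousAt_const.sub continuousAt_id) (sub_ne_zero.2 h))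
      have := this.tendsto
      rw [sub_self, zero_mul] at this
      exact this.mono_left nhdsWithin_le_nhds
  have h3 := h1.add (tendsto_finsetSum Finset.univ fun j _ => h2 j)
  rw [zero_add] at h3
  refine h3.congr fun x => ?_
  rw [eval, mul_add _ (f.a * x + f.c), Finset.mul_sum]

theorem eventually_not_isPole (f : RatHN) (p : ℝ) :
    ∀ᶠ x in nhdsWithin p {p}ᶜ, ¬ f.IsPole x := by
  have hfin : (range f.β \ {p}).Finite := (finite_range f.β).sdiff
  filter_upwards [nhdsWithin_le_nhds (hfin.isClosed.isOpen_compl.mem_nhds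
    (show p ∈ (range f.β \ {p})ᶜ by simp)), self_mem_nhdsWithin] with x hx hxp hpole
  exact hx ⟨hpole, hxp⟩

theorem eq_of_eval_eq {f g : RatHN}
    (h : ∀ x, ¬ f.IsPole x → ¬ g.IsPole x → f.eval x = g.eval x) : f = g := by
  have hw : ∀ p, f.weight p = g.weight p := by
    intro p
    refine tendsto_nhds_unique_of_eventuallyEq (f.tendsto_mul_eval p) (g.tendsto_mul_eval p) ?_
    filter_upwards [f.eventually_not_isPole p, g.eventually_not_isPole p] with x h1 h2
    rw [h x h1 h2]
  have hr : range f.β = range g.β := by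
    ext p
    rw [← weight_ne_zero_iff, ← weight_ne_zero_iff, hw]
  obtain ⟨k₁, hk₁, H₁⟩ := f.exists_eval_neg_sq_le
  obtain ⟨k₂, hk₂, H₂⟩ := g.exists_eval_neg_sq_le
  have hwf := f.weight_β
  have hwg := g.weight_β
  have hn : f.n = g.n := by
    have h1 := Nat.card_range_of_injective f.hβ.injective
    have h2 := Nat.card_range_of_injective g.hβ.injective
    rw [hr, h2] at h1
    simpa using h1.symm
  obtain ⟨a₁, c₁, n₁, γ₁, β₁, ha₁, hγ₁, hβ₁⟩ := f
  obtain ⟨a₂, c₂, n₂, γ₂, β₂, ha₂, hγ₂, hβ₂⟩ := g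
  simp only at hn hr hwf hwg
  subst hn
  obtain rfl : β₁ = β₂ := (hβ₁.range_inj hβ₂).1 hr
  obtain rfl : γ₁ = γ₂ := by
    ext i
    rw [← hwf, ← hwg, hw]
  have key : ∀ k, k₁ + k₂ ≤ k → a₁ * -k ^ 2 + c₁ = a₂ * -k ^ 2 + c₂ := by
    intro k hk
    have := h (-k ^ 2) (H₁ k (by linarith)).1 (H₂ k (by linarith)).1
    simpa only [eval, add_left_inj] using this
  have e1 := key (k₁ + k₂) le_rfl
  have e2 := key (k₁ + k₂ + 1) (by linarith)
  obtain rfl : a₁ = a₂ := by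
    have e3 : (a₁ - a₂) * (2 * (k₁ + k₂) + 1) = 0 := by linear_combination e1 - e2
    exact sub_eq_zero.1 ((mul_eq_zero.1 e3).resolve_right (by linarith))
  obtain rfl : c₁ = c₂ := by linarith
  rfl

end RatHN

theorem IsCaraSol.isSol {q : ℝ → ℝ} {L lam : ℝ} {y y' : ℝ → ℝ} (hL : 0 ≤ L)
    (hq : IntervalIntegrable (fun t => (q t : ℂ)) volume 0 L) (h : IsCaraSol q L lam y y') :
    IsSol (fun t => (q t : ℂ)) L lam (fun t => (y t : ℂ)) (fun t => (y' t : ℂ)) := by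
  obtain ⟨h1, h2, h3, h4⟩ := h
  rw [← uIcc_of_le hL] at h1 h2
  have c1 : ContinuousOn (fun t => (y t : ℂ)) (uIcc 0 L) :=
    Complex.continuous_ofReal.comp_continuousOn h1
  have c2 : ContinuousOn (fun t => (y' t : ℂ)) (uIcc 0 L) :=
    Complex.continuous_ofReal.comp_continuousOn h2
  refine ⟨⟨c2.intervalIntegrable, fun x hx => ?_⟩,
    ⟨(hq.sub intervalIntegrable_const).mul_continuousOn c1, fun x hx => ?_⟩⟩
  · simp only
    rw [h3 x hx, intervalIntegral.integral_ofReal]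
    push_cast
    rfl
  · simp only
    rw [h4 x hx, Complex.ofReal_add, ← intervalIntegral.integral_ofReal]
    push_cast
    rfl

theorem IsSol.congr_ae {Q₁ Q₂ : ℝ → ℂ} {L : ℝ} (hL : 0 ≤ L) {lam : ℂ} {y z : ℝ → ℂ}
    (h : IsSol Q₁ L lam y z) (hQ : ∀ᵐ x, x ∈ Ioo (0:ℝ) L → Q₁ x = Q₂ x) :
    IsSol Q₂ L lam y z := by
  have hQ' : ∀ᵐ x, x ≠ L → x ∈ Ioc (0:ℝ) L → (Q₁ x - lam) * y x = (Q₂ x - lam) * y x := by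
    filter_upwards [hQ] with x hx hne hxI
    rw [hx ⟨hxI.1, lt_of_le_of_ne hxI.2 hne⟩]
  have hQ'' : ∀ᵐ x, x ∈ Ioc (0:ℝ) L → (Q₁ x - lam) * y x = (Q₂ x - lam) * y x := by
    filter_upwards [hQ', Measure.ae_ne volume L] with x h1 h2 using h1 h2
  refine ⟨h.1, ?_, fun x hx => ?_⟩
  · refine h.2.1.congr_ae ?_
    rw [uIoc_of_le hL]
    exact (ae_restrict_iff' measurableSet_Ioc).2 hQ''
  · rw [h.2.2 x hx]
    congr 1
    refine intervalIntegral.integral_congr_ae ?_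
    filter_upwards [hQ''] with t ht hxt
    rw [uIoc_of_le hx.1] at hxt
    exact ht ⟨hxt.1, hxt.2.trans hx.2⟩

theorem logDeriv_determines_problem
    (q₁ q₂ : ℝ → ℝ)
    (hq₁ : IntegrableOn q₁ (Ioo 0 Real.pi))
    (hq₂ : IntegrableOn q₂ (Ioo 0 Real.pi))
    (f₁ f₂ : RatHN)
    (Φ₁ Φ₁' Φ₂ Φ₂' : ℝ → ℝ → ℝ)
    (hΦ₁ : ∀ lam : ℝ, ¬ f₁.IsPole lam →
      IsCaraSol q₁ Real.pi lam (Φ₁ lam) (Φ₁' lam) ∧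
      Φ₁ lam 0 = 1 ∧ Φ₁' lam 0 = -f₁.eval lam)
    (hΦ₂ : ∀ lam : ℝ, ¬ f₂.IsPole lam →
      IsCaraSol q₂ Real.pi lam (Φ₂ lam) (Φ₂' lam) ∧
      Φ₂ lam 0 = 1 ∧ Φ₂' lam 0 = -f₂.eval lam)
    (heq : ∀ lam : ℝ, ¬ f₁.IsPole lam → ¬ f₂.IsPole lam →
      Φ₁' lam Real.pi * Φ₂ lam Real.pi = Φ₂' lam Real.pi * Φ₁ lam Real.pi) :
    (∀ᵐ x : ℝ ∂volume, x ∈ Ioo 0 Real.pi → q₁ x = q₂ x) ∧ f₁ = f₂ := by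
  have hπ : 0 < Real.pi := Real.pi_pos
  have toInt : ∀ q : ℝ → ℝ, IntegrableOn q (Ioo 0 Real.pi) →
      IntervalIntegrable (fun t => (q t : ℂ)) volume 0 Real.pi := fun q hq =>
    (intervalIntegrable_iff_integrableOn_Ioo_of_le hπ.le).2 (Integrable.ofReal hq)
  have hQ₁ := toInt q₁ hq₁
  have hQ₂ := toInt q₂ hq₂
  have reflectInt : ∀ Q : ℝ → ℂ, IntervalIntegrable Q volume 0 Real.pi →
      IntervalIntegrable (fun s => Q (Real.pi - s)) volume 0 Real.pi := fun Q hQ => by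
    simpa using (hQ.comp_sub_left Real.pi).symm
  obtain ⟨u₁, u₁', v₁, v₁', F₁⟩ := exists_isFund hπ.le (reflectInt _ hQ₁)
  obtain ⟨u₂, u₂', v₂, v₂', F₂⟩ := exists_isFund hπ.le (reflectInt _ hQ₂)
  obtain ⟨k₁, -, H₁⟩ := f₁.exists_eval_neg_sq_le
  obtain ⟨k₂, -, H₂⟩ := f₂.exists_eval_neg_sq_le
  have hcross := fun s hs => fund_cross_eq hπ hQ₁ hQ₂ F₁ F₂ (k₀ := max k₁ k₂) (fun k hk => by
    obtain ⟨p1, e1⟩ := H₁ k ((le_max_left _ _).trans hk)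
    obtain ⟨p2, e2⟩ := H₂ k ((le_max_right _ _).trans hk)
    obtain ⟨s1, i1, i1'⟩ := hΦ₁ _ p1
    obtain ⟨s2, i2, i2'⟩ := hΦ₂ _ p2
    have t1 := s1.isSol hπ.le hQ₁
    have t2 := s2.isSol hπ.le hQ₂
    have hcast : ((-k ^ 2 : ℝ) : ℂ) = -(k:ℂ) ^ 2 := by push_cast; rfl
    rw [hcast] at t1 t2
    exact ⟨-f₁.eval (-k ^ 2), -f₂.eval (-k ^ 2), _, _, _, _, by linarith, by linarith, t1, t2, by simp [i1], by rw [i1'],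
      by simp [i2], by rw [i2'], by exact_mod_cast heq _ p1 p2⟩) 0 (s := s) hs
  have hrefl := ae_eq_of_cross_eq hπ (F₁.solU 0) (F₁.solV 0) (F₂.solU 0) (F₂.solV 0)
    (F₁.u_zero 0) (F₁.u'_zero 0) (F₁.v_zero 0) (F₁.v'_zero 0)
    (F₂.u_zero 0) (F₂.u'_zero 0) (F₂.v_zero 0) (F₂.v'_zero 0) hcross
  have hae : ∀ᵐ x : ℝ ∂volume, x ∈ Ioo 0 Real.pi → q₁ x = q₂ x := by
    filter_upwards [(Measure.measurePreserving_sub_left volume Real.pi).quasiMeasurePreserving.ae hrefl]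
      with x hx hxI
    have := hx ⟨by linarith [hxI.2], by linarith [hxI.1]⟩
    rw [sub_sub_cancel] at this
    exact_mod_cast this
  refine ⟨hae, RatHN.eq_of_eval_eq fun lam p1 p2 => ?_⟩
  obtain ⟨s1, i1, i1'⟩ := hΦ₁ _ p1
  obtain ⟨s2, i2, i2'⟩ := hΦ₂ _ p2
  have t1 := (s1.isSol hπ.le hQ₁).congr_ae (Q₂ := fun t => (q₂ t : ℂ)) hπ.le (by
    filter_upwards [hae] with x hx hxI
    rw [hx hxI])
  have hw := t1.wronskian hπ.le (s2.isSol hπ.le hQ₂) (right_mem_Icc.2 hπ.le)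
  have hw' : Φ₁ lam Real.pi * Φ₂' lam Real.pi - Φ₁' lam Real.pi * Φ₂ lam Real.pi =
      Φ₁ lam 0 * Φ₂' lam 0 - Φ₁' lam 0 * Φ₂ lam 0 := by exact_mod_cast hw
  rw [i1, i1', i2, i2'] at hw'
  linear_combination -heq lam p1 p2 - hw'
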